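/- Let f_{n,k} denote the number of equivalence classes of the relation ∼_ne on Π_{n,k}. Then f_{n,1} = 1 for every n ≥ 1, and for every n ≥ k ≥ 2, f_{n,k} = Σ_{r=k−1}^{n−1} f_{r,k−1} + (k−1)·C(n−2, k), where C(n−2,k) is a binomial coefficient. -/

import Mathlib

open Finset

/-- A set partition of `[n] = {1,…,n}`, modeled as a `Finpartition` of `Fin n`. -/
abbrev SetPartition (n : ℕ) := Finpartition (Finset.univ : Finset (Fin n))

/-- `(i,j)` is an arc of the partition `p`: `i < j`, they lie in a common block,
and no element of that block lies strictly between them. -/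
def IsArc {n : ℕ} (p : SetPartition n) (i j : Fin n) : Prop :=
  i < j ∧ ∃ B ∈ p.parts, i ∈ B ∧ j ∈ B ∧ ∀ x ∈ B, ¬ (i < x ∧ x < j)

/-- Arcs `a = (i₁,j₁)` and `b = (i₂,j₂)` form a crossing: `i₁ < i₂ < j₁ < j₂`. -/
def Crossing {n : ℕ} (a b : Fin n × Fin n) : Prop :=
  a.1 < b.1 ∧ b.1 < a.2 ∧ a.2 < b.2

/-- Arcs `a = (i₁,j₁)` and `b = (i₂,j₂)` form a nesting: `i₁ < i₂ < j₂ < j₁`. -/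
def Nesting {n : ℕ} (a b : Fin n × Fin n) : Prop :=
  a.1 < b.1 ∧ b.1 < b.2 ∧ b.2 < a.2

/-- `cr p`: the number of crossings of two arcs in `p`. -/
noncomputable def cr {n : ℕ} (p : SetPartition n) : ℕ :=
  {e : (Fin n × Fin n) × (Fin n × Fin n) |
    IsArc p e.1.1 e.1.2 ∧ IsArc p e.2.1 e.2.2 ∧ Crossing e.1 e.2}.ncard

/-- `ne' p`: the number of nestings of two arcs in `p`. -/
noncomputable def ne' {n : ℕ} (p : SetPartition n) : ℕ :=
  {e : (Fin n × Fin n) × (Fin n × Fin n) |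
    IsArc p e.1.1 e.1.2 ∧ IsArc p e.2.1 e.2.2 ∧ Nesting e.1 e.2}.ncard

/-- `al p`: the number of alignments (unordered pairs of arcs that neither
cross nor nest, counted with first endpoints in increasing order). -/
noncomputable def al {n : ℕ} (p : SetPartition n) : ℕ :=
  {e : (Fin n × Fin n) × (Fin n × Fin n) |
    IsArc p e.1.1 e.1.2 ∧ IsArc p e.2.1 e.2.2 ∧ e.1.1 < e.2.1 ∧
    ¬ Crossing e.1 e.2 ∧ ¬ Crossing e.2 e.1 ∧
    ¬ Nesting e.1 e.2 ∧ ¬ Nesting e.2 e.1}.ncard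

/-- `i` and `j` lie in a common block of `p`. -/
def InSameBlock {n : ℕ} (p : SetPartition n) (i j : Fin n) : Prop :=
  ∃ B ∈ p.parts, i ∈ B ∧ j ∈ B

/-- `c` (a partition of `[n+1]`) is a child of `p` (a partition of `[n]`):
deleting the element `1` from `c` and shifting down by one yields `p`. -/
def IsChild {n : ℕ} (c : SetPartition (n + 1)) (p : SetPartition n) : Prop :=
  ∀ i j : Fin n, (InSameBlock p i j ↔ InSameBlock c i.succ j.succ)

/-- `level p l` is `T(p, l)`: the set of partitions of `[n+l]` at the `l`-th level of
the subtree rooted at `p` in the tree of partitions. -/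
def level {n : ℕ} (p : SetPartition n) : (l : ℕ) → Set (SetPartition (n + l))
  | 0 => {p}
  | l + 1 => {c | ∃ q ∈ level p l, IsChild c q}

/-- The statistic `s_{α,β}(p) = cr(p)·α + ne(p)·β`. -/
noncomputable def statS {G : Type*} [AddCommGroup G] (α β : G) {n : ℕ} (p : SetPartition n) : G :=
  cr p • α + ne' p • β

/-- The minimum of a block, as a natural number (`0` for the empty set). -/
noncomputable def minOfBlock {n : ℕ} (B : Finset (Fin n)) : ℕ :=
  sInf (Fin.val '' (B : Set (Fin n)))

/-- `u(p, b)`: the number of arcs `(x, y)` of `p` with `x < b < y` (values in `ℕ`). -/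
noncomputable def uStat {n : ℕ} (p : SetPartition n) (b : ℕ) : ℕ :=
  {e : Fin n × Fin n | IsArc p e.1 e.2 ∧ (e.1 : ℕ) < b ∧ b < (e.2 : ℕ)}.ncard

/-- `v(p, b)`: the number of arcs `(x, y)` of `p` with `x < y < b` (values in `ℕ`). -/
noncomputable def vStat {n : ℕ} (p : SetPartition n) (b : ℕ) : ℕ :=
  {e : Fin n × Fin n | IsArc p e.1 e.2 ∧ (e.2 : ℕ) < b}.ncard

/-- `crset p`: the multiset `{u₁(p), …, u_k(p)}`, where `u_i(p)` is the number of arcs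
passing over the minimum `b_i` of the `i`-th block. -/
noncomputable def crset {n : ℕ} (p : SetPartition n) : Multiset ℕ :=
  p.parts.val.map fun B => uStat p (minOfBlock B)

/-- `neseq p`: the sequence `(v₁(p), …, v_k(p))`, where `v_i(p)` is the number of arcs
lying entirely to the left of the minimum `b_i` of the `i`-th block, blocks being ordered
by increasing minima. -/
noncomputable def neseq {n : ℕ} (p : SetPartition n) : List ℕ :=
  ((p.parts.image fun B => minOfBlock B).sort (· ≤ ·)).map fun b => vStat p b

/-- `p ∼_cr q`: the statistic `cr` has the same distribution on `T(p,l,m)` and `T(q,l,m)`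
for all `l, m ≥ 0` (multiset equality expressed by counting, for each value `c`, the
partitions attaining it). -/
def SimCr {n : ℕ} (p q : SetPartition n) : Prop :=
  ∀ l m c : ℕ,
    {t ∈ level p l | t.parts.card = m ∧ cr t = c}.ncard =
    {t ∈ level q l | t.parts.card = m ∧ cr t = c}.ncard

/-- `p ∼_ne q`: the statistic `ne` has the same distribution on `T(p,l,m)` and `T(q,l,m)`
for all `l, m ≥ 0`. -/
def SimNe {n : ℕ} (p q : SetPartition n) : Prop :=
  ∀ l m c : ℕ,
    {t ∈ level p l | t.parts.card = m ∧ ne' t = c}.ncard =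
    {t ∈ level q l | t.parts.card = m ∧ ne' t = c}.ncard

/-- `∼_cr` as a setoid on `Π_{n,k}`, the partitions of `[n]` with exactly `k` blocks. -/
def crSetoid (n k : ℕ) : Setoid {p : SetPartition n // p.parts.card = k} :=
  ⟨fun p q => SimCr p.1 q.1,
    ⟨fun _ _ _ _ => rfl, fun h l m c => (h l m c).symm,
      fun h₁ h₂ l m c => (h₁ l m c).trans (h₂ l m c)⟩⟩

/-- `∼_ne` as a setoid on `Π_{n,k}`, the partitions of `[n]` with exactly `k` blocks. -/
def neSetoid (n k : ℕ) : Setoid {p : SetPartition n // p.parts.card = k} :=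
  ⟨fun p q => SimNe p.1 q.1,
    ⟨fun _ _ _ _ => rfl, fun h l m c => (h l m c).symm,
      fun h₁ h₂ l m c => (h₁ l m c).trans (h₂ l m c)⟩⟩

/-- `∼_ne` as a setoid on all of `Π_n`. -/
def neSetoidAll (n : ℕ) : Setoid (SetPartition n) :=
  ⟨SimNe,
    ⟨fun _ _ _ _ => rfl, fun h l m c => (h l m c).symm,
      fun h₁ h₂ l m c => (h₁ l m c).trans (h₂ l m c)⟩⟩

/-- `f_{n,k}`: the number of `∼_ne`-equivalence classes on `Π_{n,k}`. -/
noncomputable def fnk (n k : ℕ) : ℕ :=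
  Nat.card (Quotient (neSetoid n k))

/-- Among the partitions whose non-minimal elements form `E`, the largest number of nestings. -/
def nestBound (E : Finset ℕ) : ℕ :=
  ∑ e ∈ E, min e #E - (#E + 1).choose 2

lemma sum_range_min_le_sum_min (s K : ℕ) (F : Finset ℕ) (hF : ∀ e ∈ F, s < e) :
    ∑ j ∈ range #F, min (j + 1 + s) K ≤ ∑ e ∈ F, min e K := by
  induction F using Finset.induction_on_max with
  | empty => simp
  | insert a F ha ih =>
    have haF : a ∉ F := fun h => (ha a h).false
    have hcard : #F ≤ a - s - 1 := by
      have hsub : F ⊆ Ioo s a := fun x hx =>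
        mem_Ioo.2 ⟨hF x (mem_insert_of_mem hx), ha x hx⟩
      simpa using card_le_card hsub
    have hs : s < a := hF a (mem_insert_self a F)
    rw [card_insert_of_notMem haF, sum_range_succ, sum_insert haF]
    have := ih fun e he => hF e (mem_insert_of_mem he)
    have : min (#F + 1 + s) K ≤ min a K := min_le_min_right K (by omega)
    omega

lemma choose_two_succ (N : ℕ) : (N + 1).choose 2 = N + N.choose 2 := by
  rw [Nat.choose_succ_succ' N 1, Nat.choose_one_right]

lemma choose_two_le_sum_min {E : Finset ℕ} (hE : ∀ e ∈ E, 0 < e) :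
    (#E + 1).choose 2 ≤ ∑ e ∈ E, min e #E := by
  refine le_trans (le_of_eq ?_) (sum_range_min_le_sum_min 0 #E E hE)
  rw [sum_congr rfl (g := fun j => j + 1)]
  · generalize #E = N
    induction N with
    | zero => simp
    | succ N ih => rw [sum_range_succ, choose_two_succ, ih]; omega
  · intro j hj
    have := mem_range.1 hj
    simp only [add_zero]
    omega

lemma sum_range_min_add_three (m : ℕ) :
    ∑ j ∈ range (m + 1), min (j + 1 + 2) (m + 2) + 1 = (m + 3).choose 2 + m := by
  rw [sum_range_succ, sum_congr rfl (g := fun j => j + 3)]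
  · have h : ∑ j ∈ range m, (j + 3) + 3 = (m + 3).choose 2 := by
      induction m with
      | zero => simp
      | succ m ih => rw [sum_range_succ, choose_two_succ (m + 3), ← ih]; omega
    rw [← h, min_eq_right (by omega)]
    omega
  · intro j hj
    have := mem_range.1 hj
    omega

lemma card_image_succ (E : Finset ℕ) : #(E.image (· + 1)) = #E :=
  card_image_of_injective _ (add_left_injective 1)

lemma succ_mem_image_succ {E : Finset ℕ} {b : ℕ} : b + 1 ∈ E.image (· + 1) ↔ b ∈ E := by
  simp

lemma nestBound_insert_image_succ {E : Finset ℕ} {b : ℕ} (hE : ∀ e ∈ E, 0 < e) (hb : b ∉ E) :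
    nestBound (insert (b + 1) (E.image (· + 1))) = nestBound E + min b #E := by
  have h := choose_two_le_sum_min hE
  have hb' : b + 1 ∉ E.image (· + 1) := by simpa using hb
  rw [nestBound, nestBound, card_insert_of_notMem hb', card_image_succ, sum_insert hb',
    sum_image (by simp), choose_two_succ (#E + 1)]
  have : ∑ x ∈ E, min (x + 1) (#E + 1) = ∑ x ∈ E, min x #E + #E := by
    simp [Nat.add_min_add_right, sum_add_distrib]
  rw [this, Nat.add_min_add_right]
  omega

lemma nestBound_le_image_succ (E : Finset ℕ) :
    nestBound E ≤ nestBound (E.image (· + 1)) := by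
  rw [nestBound, nestBound, card_image_succ, sum_image (by simp)]
  refine Nat.sub_le_sub_right (sum_le_sum fun e _ => min_le_min_right _ (by omega)) _

lemma card_filter_lt_le_min (E : Finset ℕ) (b : ℕ) : #{e ∈ E | e < b} ≤ min b #E := by
  refine le_min ?_ (card_filter_le _ _)
  have : {e ∈ E | e < b} ⊆ range b := fun x hx => by simpa using (mem_filter.1 hx).2
  simpa using card_le_card this

lemma exists_eq_insert_image_succ {n e : ℕ} {E : Finset ℕ} (hE : E ⊆ Icc 1 n) (he : e ∈ E)
    (h1 : 1 ∈ E → e = 1) :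
    ∃ E' b, E' ⊆ Icc 1 (n - 1) ∧ b < n ∧ b ∉ E' ∧ E = insert (b + 1) (E'.image (· + 1)) ∧
      b + 1 = e ∧ #{x ∈ E' | x < b} = #{x ∈ E | x < e} := by
  have hE' : ∀ x ∈ E, 1 ≤ x ∧ x ≤ n := fun x hx => mem_Icc.1 (hE hx)
  have hpos := hE' e he
  have key : ∀ x, x ∈ (E.erase e).image (· - 1) ↔ x + 1 ∈ E ∧ x + 1 ≠ e := by
    intro x
    simp only [mem_image, mem_erase]
    constructor
    · rintro ⟨y, ⟨hye, hy⟩, rfl⟩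
      have := hE' y hy
      rw [Nat.sub_add_cancel this.1]
      exact ⟨hy, hye⟩
    · rintro ⟨hx, hxe⟩
      exact ⟨x + 1, ⟨hxe, hx⟩, rfl⟩
  refine ⟨(E.erase e).image (· - 1), e - 1, ?_, by omega, ?_, ?_, by omega, ?_⟩
  · intro x hx
    obtain ⟨hx, hxe⟩ := (key x).1 hx
    have := hE' _ hx
    rw [mem_Icc]
    refine ⟨Nat.pos_of_ne_zero ?_, by omega⟩
    rintro rfl
    exact hxe (h1 hx).symm
  · rw [key]
    omega
  · ext x
    rw [mem_insert, Nat.sub_add_cancel hpos.1, mem_image]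
    constructor
    · intro hx
      rcases eq_or_ne x e with h | h
      · exact .inl h
      · have := hE' x hx
        exact .inr ⟨x - 1, (key _).2 (by rw [Nat.sub_add_cancel this.1]; exact ⟨hx, h⟩), by omega⟩
    · rintro (rfl | ⟨y, hy, rfl⟩)
      · exact he
      · exact ((key y).1 hy).1
  · refine card_bij (fun x _ => x + 1) ?_ (by simp) ?_
    · intro x hx
      rw [mem_filter, key] at hx
      rw [mem_filter]
      exact ⟨hx.1.1, by omega⟩
    · intro x hx
      rw [mem_filter] at hx
      have := hE' x hx.1
      refine ⟨x - 1, ?_, by omega⟩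
      rw [mem_filter, key, Nat.sub_add_cancel this.1]
      exact ⟨⟨hx.1, by omega⟩, by omega⟩

lemma le_nestBound_add {E : Finset ℕ} {a : ℕ} (ha : a ∈ E) (h2 : ∀ e ∈ E, 2 ≤ e)
    (hmin : ∀ e ∈ E, a ≤ e) : #E - 1 + min (a - 1) (#E - 1) ≤ nestBound E + 1 := by
  have hcard := card_erase_add_one ha
  rw [nestBound, ← add_sum_erase E _ ha]
  have ha2 := h2 a ha
  rcases hm : #(E.erase a) with _ | m
  · rw [hm] at hcard
    simp [← hcard]
  · have hF : ∀ e ∈ E.erase a, 2 < e := fun e he => by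
      have h := mem_erase.1 he
      have := hmin e h.2
      omega
    have h := sum_range_min_le_sum_min 2 (m + 2) (E.erase a) hF
    have h' := sum_range_min_add_three m
    rw [hm] at hcard h
    rw [← hcard, choose_two_succ]
    have : (m + 3).choose 2 = (m + 2) + (m + 2).choose 2 := choose_two_succ _
    norm_num only [add_assoc] at *
    omega

lemma exists_predecessor {n c : ℕ} {E : Finset ℕ} (hE : E ⊆ Icc 1 n) (hne : E.Nonempty)
    (hc : c ≤ nestBound E) :
    ∃ E' b, E' ⊆ Icc 1 (n - 1) ∧ b < n ∧ b ∉ E' ∧ E = insert (b + 1) (E'.image (· + 1)) ∧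
      #{x ∈ E' | x < b} ≤ c ∧ c - #{x ∈ E' | x < b} ≤ nestBound E' := by
  have hpos : ∀ E' : Finset ℕ, E' ⊆ Icc 1 (n - 1) → ∀ e ∈ E', 0 < e :=
    fun E' h e he => (mem_Icc.1 (h he)).1
  have hmin : ∀ e ∈ E, E.min' hne ≤ e := fun e he => min'_le E e he
  have hv : #{x ∈ E | x < E.min' hne} = 0 := by
    rw [card_eq_zero, filter_eq_empty_iff]
    exact fun x hx => not_lt.2 (hmin x hx)
  have h1 : 1 ∈ E → E.min' hne = 1 := fun h =>
    le_antisymm (hmin 1 h) (mem_Icc.1 (hE (min'_mem E hne))).1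
  by_cases hlow : c + min (E.min' hne - 1) (#E - 1) ≤ nestBound E
  · obtain ⟨E', b, hE', hbn, hb, rfl, hbe, hcard⟩ :=
      exists_eq_insert_image_succ hE (min'_mem E hne) h1
    refine ⟨E', b, hE', hbn, hb, rfl, by omega, ?_⟩
    rw [nestBound_insert_image_succ (hpos E' hE') hb, ← hbe,
      card_insert_of_notMem (by simpa using hb), card_image_succ] at hlow
    simp only [Nat.add_sub_cancel] at hlow
    omega
  · have h1' : 1 ∉ E := fun h => hlow (by simpa [h1 h] using hc)
    have h2 : ∀ e ∈ E, 2 ≤ e := fun e he => by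
      have := (mem_Icc.1 (hE he)).1
      have : e ≠ 1 := fun h => h1' (h ▸ he)
      omega
    have hbound := le_nestBound_add (min'_mem E hne) h2 hmin
    obtain ⟨E', b, hE', hbn, hb, hins, hbe, hcard⟩ :=
      exists_eq_insert_image_succ hE (max'_mem E hne) fun h => absurd h h1'
    have hall : ∀ x ∈ E', x < b := fun x hx => by
      have hxE : x + 1 ∈ E := by rw [hins]; simp [hx]
      have := le_max' E _ hxE
      have : x ≠ b := fun h => hb (h ▸ hx)
      omega
    have hfil : {x ∈ E' | x < b} = E' := filter_true_of_mem hall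
    have hcE : #E = #E' + 1 := by
      rw [hins, card_insert_of_notMem (by simpa using hb), card_image_succ]
    have hle := card_filter_lt_le_min E' b
    have hnb : nestBound E = nestBound E' + min b #E' := by
      rw [hins]
      exact nestBound_insert_image_succ (hpos E' hE') hb
    refine ⟨E', b, hE', hbn, hb, hins, ?_, ?_⟩ <;> rw [hfil] at * <;> omega

lemma eq_of_card_filter_eq {n : ℕ} {E F : Finset ℕ} (hE : E ⊆ range n) (hF : F ⊆ range n)
    (h : ∀ d, #{b ∈ range n | b ∉ E ∧ #{x ∈ E | x < b} = d} =
      #{b ∈ range n | b ∉ F ∧ #{x ∈ F | x < b} = d}) : E = F := by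
  by_contra hne
  have hex : ∃ x, ¬ (x ∈ E ↔ x ∈ F) := by
    by_contra! hall
    exact hne (ext hall)
  wlog hx : Nat.find hex ∉ E generalizing E F
  · have hex' : ∃ x, ¬ (x ∈ F ↔ x ∈ E) := by simpa only [iff_comm] using hex
    refine this hF hE (fun d => (h d).symm) (Ne.symm hne) hex' ?_
    have hfind : Nat.find hex' = Nat.find hex := by simp only [iff_comm]
    rw [hfind]
    have := Nat.find_spec hex
    tauto
  set x := Nat.find hex with hxdef
  have hxF : x ∈ F := by
    have := Nat.find_spec hex
    tauto
  have hlt : ∀ y < x, (y ∈ E ↔ y ∈ F) := fun y hy => not_not.1 (Nat.find_min hex hy)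
  have hfil : ∀ y ≤ x, {z ∈ E | z < y} = {z ∈ F | z < y} := fun y hy => by
    ext z
    simp only [mem_filter]
    exact and_congr_left fun hz => hlt z (by omega)
  refine (card_lt_card (ssubset_iff_of_subset (fun b hb => ?_) |>.2
    ⟨x, ?_, ?_⟩)).ne (h #{z ∈ E | z < x}).symm
  · simp only [mem_filter] at hb ⊢
    obtain ⟨hbn, hbF, hbd⟩ := hb
    have hbx : b < x := by
      by_contra! hxb
      have hxb' : x < b := lt_of_le_of_ne hxb fun h => hbF (h ▸ hxF)
      have hss : {z ∈ F | z < x} ⊂ {z ∈ F | z < b} := by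
        refine ssubset_iff_of_subset (fun z hz => ?_) |>.2 ⟨x, ?_, ?_⟩
        · simp only [mem_filter] at hz ⊢
          exact ⟨hz.1, by omega⟩
        · simp [hxF, hxb']
        · simp
      have := card_lt_card hss
      rw [hbd, hfil x le_rfl] at this
      omega
    refine ⟨hbn, fun hbE => hbF ((hlt b hbx).1 hbE), ?_⟩
    rw [hfil b hbx.le, hbd]
  · simp only [mem_filter]
    exact ⟨hF hxF, hx, trivial⟩
  · simp [hxF]

/-- The number of pairs `(E, c)` with `E ⊆ [1, N + k]`, `|E| = N` and `c ≤ nestBound E`. -/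
def countPairs (N k : ℕ) : ℕ :=
  ∑ E ∈ powersetCard N (Icc 1 (N + k)), (nestBound E + 1)

lemma countPairs_zero (k : ℕ) : countPairs 0 k = 1 := by
  simp [countPairs, nestBound]

lemma countPairs_blocks_zero (N : ℕ) : countPairs N 0 = 1 := by
  have h := powersetCard_self (Icc 1 N)
  rw [Nat.card_Icc, Nat.add_sub_cancel] at h
  rw [countPairs, add_zero, h, sum_singleton, nestBound, Nat.card_Icc, Nat.add_sub_cancel,
    sum_congr rfl (g := fun e => e) fun e he => min_eq_left (mem_Icc.1 he).2]
  have : ∑ e ∈ Icc 1 N, e = (N + 1).choose 2 := by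
    clear h
    induction N with
    | zero => simp
    | succ N ih => rw [sum_Icc_succ_top (by omega), ih, choose_two_succ (N + 1)]; omega
  rw [this, Nat.sub_self]

lemma nestBound_insert_top {E : Finset ℕ} {a : ℕ} (hE : ∀ e ∈ E, 0 < e ∧ e < a)
    (ha : #E < a) : nestBound (insert a E) = nestBound E + #{e ∈ E | #E < e} := by
  have haE : a ∉ E := fun h => (hE a h).2.false
  have h := choose_two_le_sum_min fun e he => (hE e he).1
  rw [nestBound, nestBound, card_insert_of_notMem haE, sum_insert haE, choose_two_succ (#E + 1)]
  have : ∑ e ∈ E, min e (#E + 1) = ∑ e ∈ E, min e #E + #{e ∈ E | #E < e} := by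
    rw [card_filter, ← sum_add_distrib]
    refine sum_congr rfl fun e _ => ?_
    split_ifs <;> omega
  rw [this]
  omega

lemma sum_powersetCard_card_filter {α : Type*} [DecidableEq α] (s : Finset α) (N : ℕ)
    (P : α → Prop) [DecidablePred P] :
    ∑ E ∈ powersetCard (N + 1) s, #{e ∈ E | P e} = #{e ∈ s | P e} * (#s - 1).choose N := by
  have : ∀ E ∈ powersetCard (N + 1) s, #{e ∈ E | P e} =
      ∑ x ∈ s with P x, if x ∈ E then 1 else 0 := fun E hE => by
    rw [← card_filter]
    congr 1
    ext x
    simp only [mem_filter]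
    have := (mem_powersetCard.1 hE).1
    grind
  rw [sum_congr rfl this, sum_comm, sum_const_nat (m := (#s - 1).choose N)]
  intro x hx
  have hxs := (mem_filter.1 hx).1
  rw [← card_filter, ← card_erase_of_mem hxs, ← card_powersetCard]
  refine card_bij' (fun E _ => E.erase x) (fun E _ => insert x E) ?_ ?_ ?_ ?_
  · intro E hE
    simp only [mem_filter, mem_powersetCard] at hE ⊢
    exact ⟨erase_subset_erase x hE.1.1, by rw [card_erase_of_mem hE.2]; omega⟩
  · intro E hE
    simp only [mem_filter, mem_powersetCard] at hE ⊢
    have hxE : x ∉ E := fun h => by simpa using hE.1 h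
    refine ⟨⟨insert_subset hxs (hE.1.trans (erase_subset x s)), ?_⟩, mem_insert_self x E⟩
    rw [card_insert_of_notMem hxE, hE.2]
  · intro E hE
    exact insert_erase (mem_filter.1 hE).2
  · intro E hE
    refine erase_insert fun h => ?_
    simpa using (mem_powersetCard.1 hE).1 h

lemma countPairs_succ_succ (N k : ℕ) :
    countPairs (N + 1) (k + 1) =
      countPairs (N + 1) k + countPairs N (k + 1) + (k + 1) * (N + k).choose (k + 1) := by
  have htop : Icc 1 (N + 1 + (k + 1)) = insert (N + k + 2) (Icc 1 (N + k + 1)) := by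
    ext x
    simp only [mem_insert, mem_Icc]
    omega
  have hnot : N + k + 2 ∉ Icc 1 (N + k + 1) := by simp
  have hmem : ∀ E ∈ powersetCard N (Icc 1 (N + k + 1)), ∀ e ∈ E, 0 < e ∧ e < N + k + 2 :=
    fun E hE e he => by
      have := mem_Icc.1 ((mem_powersetCard.1 hE).1 he)
      omega
  rw [countPairs, htop, powersetCard_succ_insert hnot, sum_union, sum_image,
    add_assoc (countPairs (N + 1) k)]
  · congr 1
    · rw [countPairs, show N + 1 + k = N + k + 1 by omega]
    · have : ∀ E ∈ powersetCard N (Icc 1 (N + k + 1)), nestBound (insert (N + k + 2) E) + 1 =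
          (nestBound E + 1) + #{e ∈ E | N < e} := fun E hE => by
        have hc := (mem_powersetCard.1 hE).2
        rw [nestBound_insert_top (hmem E hE) (by omega), hc]
        omega
      rw [sum_congr rfl this, sum_add_distrib, countPairs, ← add_assoc]
      congr 1
      rcases N with _ | N
      · simp
      · rw [sum_powersetCard_card_filter]
        have : {e ∈ Icc 1 (N + 1 + k + 1) | N + 1 < e} = Icc (N + 2) (N + k + 2) := by
          ext x
          simp only [mem_filter, mem_Icc]
          omega
        rw [this, Nat.card_Icc, Nat.card_Icc]
        congr 1
        · omega
        · rw [← Nat.choose_symm_of_eq_add (a := N) (b := k + 1) (by omega)]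
          congr 1
  · intro E hE F hF hEF
    have hE' : N + k + 2 ∉ E := fun h => ((hmem E hE) _ h).2.false
    have hF' : N + k + 2 ∉ F := fun h => ((hmem F hF) _ h).2.false
    rw [← erase_insert hE', ← erase_insert hF']
    exact congrArg (fun s => s.erase (N + k + 2)) hEF
  · rw [disjoint_left]
    intro E hE hE'
    obtain ⟨F, -, rfl⟩ := mem_image.1 hE'
    exact hnot ((mem_powersetCard.1 hE).1 (mem_insert_self _ F))

lemma countPairs_succ_eq_sum (N k : ℕ) :
    countPairs N (k + 1) =
      ∑ M ∈ range (N + 1), countPairs M k + (k + 1) * (N + k).choose (k + 2) := by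
  induction N with
  | zero => simp [countPairs_zero, Nat.choose_eq_zero_of_lt]
  | succ N ih =>
    rw [countPairs_succ_succ, ih, sum_range_succ _ (N + 1),
      show N + 1 + k = N + k + 1 by omega, Nat.choose_succ_succ' (N + k) (k + 1)]
    ring

lemma inSameBlock_iff_mem_part {n : ℕ} {p : SetPartition n} {i j : Fin n} :
    InSameBlock p i j ↔ i ∈ p.part j :=
  p.mem_part_iff_exists.symm

lemma inSameBlock_equivalence {n : ℕ} (p : SetPartition n) : Equivalence (InSameBlock p) where
  refl i := inSameBlock_iff_mem_part.2 (p.mem_part (mem_univ i))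
  symm := fun ⟨B, hB, hi, hj⟩ => ⟨B, hB, hj, hi⟩
  trans := by
    rintro i j l ⟨B, hB, hi, hj⟩ ⟨C, hC, hj', hl⟩
    obtain rfl := p.eq_of_mem_parts hB hC hj hj'
    exact ⟨B, hB, hi, hl⟩

lemma parts_eq_image_part {n : ℕ} (p : SetPartition n) : p.parts = univ.image p.part := by
  ext B
  simp only [mem_image, mem_univ, true_and]
  constructor
  · intro hB
    obtain ⟨x, hx⟩ := p.nonempty_of_mem_parts hB
    exact ⟨x, p.part_eq_of_mem hB hx⟩
  · rintro ⟨x, rfl⟩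
    exact p.part_mem.2 (mem_univ x)

lemma setPartition_ext {n : ℕ} {p q : SetPartition n}
    (h : ∀ i j, InSameBlock p i j ↔ InSameBlock q i j) : p = q := by
  have hpart : p.part = q.part := by
    funext j
    ext i
    rw [← inSameBlock_iff_mem_part, ← inSameBlock_iff_mem_part, h]
  ext1
  rw [parts_eq_image_part, parts_eq_image_part, hpart]

lemma exists_setPartition {n : ℕ} (s : Setoid (Fin n)) :
    ∃ p : SetPartition n, ∀ i j, InSameBlock p i j ↔ s i j := by
  classical
  refine ⟨Finpartition.ofSetoid s, fun i j => ?_⟩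
  rw [inSameBlock_iff_mem_part, Finpartition.mem_part_ofSetoid_iff_rel]
  exact ⟨s.symm', s.symm'⟩

/-- `b` is the least element of its block. -/
def IsBlockMin {n : ℕ} (p : SetPartition n) (b : Fin n) : Prop :=
  ∀ y, InSameBlock p y b → b ≤ y

open Classical in
/-- The elements of `p`, as natural numbers, that are not the least element of their block. -/
noncomputable def nonMins {n : ℕ} (p : SetPartition n) : Finset ℕ :=
  (univ.filter fun b => ¬ IsBlockMin p b).map Fin.valEmbedding

lemma mem_nonMins {n : ℕ} {p : SetPartition n} {e : ℕ} :
    e ∈ nonMins p ↔ ∃ b : Fin n, ¬ IsBlockMin p b ∧ (b : ℕ) = e := by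
  simp [nonMins]

lemma val_mem_nonMins {n : ℕ} {p : SetPartition n} {b : Fin n} :
    (b : ℕ) ∈ nonMins p ↔ ¬ IsBlockMin p b := by
  rw [mem_nonMins]
  constructor
  · rintro ⟨c, hc, h⟩
    rwa [← Fin.ext h]
  · exact fun h => ⟨b, h, rfl⟩

lemma nonMins_subset {n : ℕ} (p : SetPartition n) : nonMins p ⊆ Icc 1 (n - 1) := by
  intro e he
  obtain ⟨b, hb, rfl⟩ := mem_nonMins.1 he
  simp only [IsBlockMin, not_forall, not_le] at hb
  obtain ⟨y, -, hy⟩ := hb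
  rw [mem_Icc]
  omega

lemma nonMins_subset_range {n : ℕ} (p : SetPartition n) : nonMins p ⊆ range n := by
  intro e he
  obtain ⟨b, -, rfl⟩ := mem_nonMins.1 he
  simp

lemma exists_isBlockMin {n : ℕ} (p : SetPartition n) (x : Fin n) :
    ∃ b, InSameBlock p b x ∧ IsBlockMin p b := by
  have hx := (inSameBlock_equivalence p).refl x
  have hne : (p.part x).Nonempty := ⟨x, inSameBlock_iff_mem_part.1 hx⟩
  have hmem := inSameBlock_iff_mem_part.2 (min'_mem _ hne)
  exact ⟨(p.part x).min' hne, hmem, fun y hy =>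
    min'_le _ _ (inSameBlock_iff_mem_part.1 ((inSameBlock_equivalence p).trans hy hmem))⟩

lemma card_nonMins_add_card_parts {n : ℕ} (p : SetPartition n) :
    #(nonMins p) + #p.parts = n := by
  classical
  have hparts : #p.parts = #(univ.filter fun b => IsBlockMin p b) := by
    symm
    refine card_bij (fun b _ => p.part b) (fun b _ => p.part_mem.2 (mem_univ b)) ?_ ?_
    · intro b hb c hc h
      have hb' := (mem_filter.1 hb).2
      have hc' := (mem_filter.1 hc).2
      have hbc : InSameBlock p b c := by
        rw [inSameBlock_iff_mem_part, ← h]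
        exact p.mem_part (mem_univ b)
      exact le_antisymm (hb' c ((inSameBlock_equivalence p).symm hbc)) (hc' b hbc)
    · intro B hB
      obtain ⟨x, hx⟩ := p.nonempty_of_mem_parts hB
      obtain ⟨b, hbx, hb⟩ := exists_isBlockMin p x
      refine ⟨b, by simpa using hb, ?_⟩
      rw [p.part_eq_iff_mem hB, ← p.part_eq_of_mem hB hx]
      exact inSameBlock_iff_mem_part.1 hbx
  rw [hparts, nonMins, card_map, add_comm, card_filter_add_card_filter_not]
  simp

lemma isArc_iff {n : ℕ} {p : SetPartition n} {i j : Fin n} :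
    IsArc p i j ↔ i < j ∧ InSameBlock p i j ∧ ∀ x, InSameBlock p x j → ¬ (i < x ∧ x < j) := by
  refine and_congr_right fun _ => ⟨?_, ?_⟩
  · rintro ⟨B, hB, hi, hj, h⟩
    refine ⟨⟨B, hB, hi, hj⟩, ?_⟩
    rintro x ⟨C, hC, hx, hj'⟩
    obtain rfl := p.eq_of_mem_parts hB hC hj hj'
    exact h x hx
  · rintro ⟨⟨B, hB, hi, hj⟩, h⟩
    exact ⟨B, hB, hi, hj, fun x hx => h x ⟨B, hB, hx, hj⟩⟩

lemma IsArc.left_unique {n : ℕ} {p : SetPartition n} {i i' j : Fin n} (h : IsArc p i j)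
    (h' : IsArc p i' j) : i = i' := by
  rw [isArc_iff] at h h'
  by_contra hne
  rcases lt_or_gt_of_ne hne with hlt | hlt
  · exact h.2.2 i' h'.2.1 ⟨hlt, h'.1⟩
  · exact h'.2.2 i h.2.1 ⟨hlt, h.1⟩

lemma not_isBlockMin_iff {n : ℕ} {p : SetPartition n} {j : Fin n} :
    ¬ IsBlockMin p j ↔ ∃ i, IsArc p i j := by
  classical
  constructor
  · intro h
    have hne : {y ∈ p.part j | y < j}.Nonempty := by
      simp only [IsBlockMin, not_forall, not_le] at h
      obtain ⟨y, hy, hyj⟩ := h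
      exact ⟨y, mem_filter.2 ⟨inSameBlock_iff_mem_part.1 hy, hyj⟩⟩
    have hmem := mem_filter.1 (max'_mem _ hne)
    refine ⟨_, isArc_iff.2 ⟨hmem.2, inSameBlock_iff_mem_part.2 hmem.1, fun x hx hlt => ?_⟩⟩
    exact hlt.1.not_ge (le_max' _ _ (mem_filter.2 ⟨inSameBlock_iff_mem_part.1 hx, hlt.2⟩))
  · rintro ⟨i, hi⟩ h
    rw [isArc_iff] at hi
    exact (h i hi.2.1).not_gt hi.1

lemma ncard_arcs_left_of {n : ℕ} (p : SetPartition n) (b : Fin n) :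
    {e : Fin n × Fin n | IsArc p e.1 e.2 ∧ e.2 < b}.ncard = #{x ∈ nonMins p | x < (b : ℕ)} := by
  rw [← Set.ncard_coe_finset]
  refine Set.ncard_congr (fun e _ => (e.2 : ℕ)) ?_ ?_ ?_
  · rintro ⟨i, j⟩ ⟨harc, hj⟩
    rw [mem_coe, mem_filter, val_mem_nonMins, not_isBlockMin_iff]
    exact ⟨⟨i, harc⟩, hj⟩
  · rintro ⟨i, j⟩ ⟨i', j'⟩ ⟨h, -⟩ ⟨h', -⟩ hjj
    obtain rfl : j = j' := Fin.ext hjj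
    obtain rfl := h.left_unique h'
    rfl
  · intro x hx
    rw [mem_coe, mem_filter] at hx
    obtain ⟨j, hj, rfl⟩ := mem_nonMins.1 hx.1
    obtain ⟨i, hi⟩ := not_isBlockMin_iff.1 hj
    exact ⟨(i, j), ⟨hi, hx.2⟩, rfl⟩

/-- `c` is the child of `p` whose new first element joins the block of the element of `o`,
or forms a block on its own if `o` is empty. -/
structure IsChildAt {n : ℕ} (p : SetPartition n) (o : Option (Fin n))
    (c : SetPartition (n + 1)) : Prop where
  isChild : IsChild c p
  zero_iff : ∀ y : Fin n, InSameBlock c 0 y.succ ↔ ∃ b ∈ o, InSameBlock p b y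

lemma exists_isChildAt {n : ℕ} (p : SetPartition n) (o : Option (Fin n)) :
    ∃ c, IsChildAt p o c := by
  let s : Setoid (Fin n) := ⟨InSameBlock p, inSameBlock_equivalence p⟩
  let f : Fin (n + 1) → Option (Quotient s) :=
    Fin.cases (o.map (Quotient.mk s)) fun i => some (Quotient.mk s i)
  obtain ⟨c, hc⟩ := exists_setPartition (Setoid.ker f)
  refine ⟨c, fun i j => ?_, fun y => ?_⟩
  · rw [hc, Setoid.ker_def]
    simp only [f, Fin.cases_succ, Option.some_inj]
    exact Quotient.eq (r := s).symm
  · rw [hc, Setoid.ker_def]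
    simp only [f, Fin.cases_succ, Fin.cases_zero, Option.map_eq_some_iff]
    exact exists_congr fun b => and_congr_right fun _ => Quotient.eq (r := s)

lemma IsChildAt.eq {n : ℕ} {p : SetPartition n} {o : Option (Fin n)} {c d : SetPartition (n + 1)}
    (hc : IsChildAt p o c) (hd : IsChildAt p o d) : c = d := by
  refine setPartition_ext fun i j => ?_
  have h0 : ∀ y : Fin n, InSameBlock c 0 y.succ ↔ InSameBlock d 0 y.succ := fun y =>
    (hc.zero_iff y).trans (hd.zero_iff y).symm
  have hsymm : ∀ {q : SetPartition (n + 1)} {a b}, InSameBlock q a b ↔ InSameBlock q b a :=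
    fun {q} {_ _} => ⟨(inSameBlock_equivalence q).symm, (inSameBlock_equivalence q).symm⟩
  refine Fin.cases ?_ (fun i => ?_) i <;> refine Fin.cases ?_ (fun j => ?_) j
  · exact ⟨fun _ => (inSameBlock_equivalence d).refl 0, fun _ => (inSameBlock_equivalence c).refl 0⟩
  · exact h0 j
  · rw [hsymm, h0, hsymm]
  · exact (hc.isChild i j).symm.trans (hd.isChild i j)

lemma IsChild.exists_isChildAt {n : ℕ} {p : SetPartition n} {c : SetPartition (n + 1)}
    (h : IsChild c p) : ∃ o, (∀ b ∈ o, IsBlockMin p b) ∧ IsChildAt p o c := by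
  by_cases hy : ∃ y : Fin n, InSameBlock c 0 y.succ
  · obtain ⟨y, hy⟩ := hy
    obtain ⟨b, hby, hb⟩ := exists_isBlockMin p y
    have hcb := (h b y).1 hby
    refine ⟨some b, by simpa using hb, h, fun z => ?_⟩
    simp only [Option.mem_some_iff, exists_eq_left', h b z]
    have ht := (inSameBlock_equivalence c)
    exact ⟨fun hz => ht.trans hcb (ht.trans (ht.symm hy) hz),
      fun hz => ht.trans hy (ht.trans (ht.symm hcb) hz)⟩
  · refine ⟨none, by simp, h, fun z => ?_⟩
    simp only [Option.mem_def, reduceCtorEq, false_and, exists_false, iff_false]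
    exact fun hz => hy ⟨z, hz⟩

lemma IsChildAt.option_eq {n : ℕ} {p : SetPartition n} {o o' : Option (Fin n)}
    {c : SetPartition (n + 1)} (ho : ∀ b ∈ o, IsBlockMin p b) (ho' : ∀ b ∈ o', IsBlockMin p b)
    (h : IsChildAt p o c) (h' : IsChildAt p o' c) : o = o' := by
  have hiff : ∀ y, (∃ b ∈ o, InSameBlock p b y) ↔ ∃ b ∈ o', InSameBlock p b y := fun y =>
    (h.zero_iff y).symm.trans (h'.zero_iff y)
  have hrefl := (inSameBlock_equivalence p).refl
  rcases o with _ | b <;> rcases o' with _ | b'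
  · rfl
  · simpa using (hiff b').2 ⟨b', rfl, hrefl b'⟩
  · simpa using (hiff b).1 ⟨b, rfl, hrefl b⟩
  · have h1 : InSameBlock p b b' := by simpa using (hiff b').2 ⟨b', rfl, hrefl b'⟩
    have h2 := (inSameBlock_equivalence p).symm h1
    rw [le_antisymm (ho b rfl b' h2) (ho' b' rfl b h1)]

lemma IsChildAt.isBlockMin_succ {n : ℕ} {p : SetPartition n} {o : Option (Fin n)}
    {c : SetPartition (n + 1)} (ho : ∀ b ∈ o, IsBlockMin p b) (h : IsChildAt p o c) (x : Fin n) :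
    IsBlockMin c x.succ ↔ IsBlockMin p x ∧ x ∉ o := by
  constructor
  · intro hx
    refine ⟨fun y hy => Fin.succ_le_succ_iff.1 (hx _ ((h.isChild y x).1 hy)), fun hxo => ?_⟩
    have := hx 0 ((h.zero_iff x).2 ⟨x, hxo, (inSameBlock_equivalence p).refl x⟩)
    simp at this
  · rintro ⟨hx, hxo⟩ y hy
    induction y using Fin.cases with
    | zero =>
      obtain ⟨b, hbo, hbx⟩ := (h.zero_iff x).1 hy
      have := le_antisymm (hx b hbx) (ho b hbo x ((inSameBlock_equivalence p).symm hbx))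
      exact absurd hbo (this ▸ hxo)
    | succ y => exact Fin.succ_le_succ_iff.2 (hx y ((h.isChild y x).2 hy))

lemma IsChildAt.mem_nonMins {n : ℕ} {p : SetPartition n} {o : Option (Fin n)}
    {c : SetPartition (n + 1)} (ho : ∀ b ∈ o, IsBlockMin p b) (h : IsChildAt p o c) (e : ℕ) :
    e ∈ nonMins c ↔ (∃ b ∈ o, (b : ℕ) + 1 = e) ∨ e ∈ (nonMins p).image (· + 1) := by
  have h0 : IsBlockMin c 0 := fun y _ => Fin.zero_le y
  simp only [_root_.mem_nonMins, mem_image, Fin.exists_fin_succ, h0, not_true_eq_false, false_and,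
    false_or, h.isBlockMin_succ ho, Fin.val_succ, not_and_or, not_not]
  constructor
  · rintro ⟨b, hb | hb, rfl⟩
    · exact .inr ⟨b, ⟨b, hb, rfl⟩, rfl⟩
    · exact .inl ⟨b, hb, rfl⟩
  · rintro (⟨b, hb, rfl⟩ | ⟨_, ⟨b, hb, rfl⟩, rfl⟩)
    · exact ⟨b, .inr hb, rfl⟩
    · exact ⟨b, .inl hb, rfl⟩

lemma IsChildAt.nonMins_none {n : ℕ} {p : SetPartition n} {c : SetPartition (n + 1)}
    (h : IsChildAt p none c) : nonMins c = (nonMins p).image (· + 1) := by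
  ext e
  simp [h.mem_nonMins (by simp)]

lemma IsChildAt.nonMins_some {n : ℕ} {p : SetPartition n} {b : Fin n} {c : SetPartition (n + 1)}
    (hb : IsBlockMin p b) (h : IsChildAt p (some b) c) :
    nonMins c = insert ((b : ℕ) + 1) ((nonMins p).image (· + 1)) := by
  ext e
  rw [h.mem_nonMins (by simpa using hb), mem_insert]
  simp [eq_comm]

lemma IsChildAt.isArc_succ {n : ℕ} {p : SetPartition n} {o : Option (Fin n)}
    {c : SetPartition (n + 1)} (h : IsChildAt p o c) (i j : Fin n) :
    IsArc c i.succ j.succ ↔ IsArc p i j := by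
  simp only [isArc_iff, Fin.succ_lt_succ_iff, ← h.isChild i j, Fin.forall_fin_succ,
    ← h.isChild _ j, Fin.not_lt_zero, false_and, not_false_eq_true, implies_true, true_and]

lemma IsChildAt.isArc_zero {n : ℕ} {p : SetPartition n} {o : Option (Fin n)}
    {c : SetPartition (n + 1)} (ho : ∀ b ∈ o, IsBlockMin p b) (h : IsChildAt p o c) (j : Fin n) :
    IsArc c 0 j.succ ↔ j ∈ o := by
  constructor
  · intro hj
    have hmin := not_isBlockMin_iff.2 ⟨_, hj⟩
    rw [h.isBlockMin_succ ho, not_and_not_right] at hmin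
    refine hmin fun y hy => ?_
    by_contra! hlt
    exact (isArc_iff.1 hj).2.2 y.succ ((h.isChild y j).1 hy)
      ⟨Fin.succ_pos y, Fin.succ_lt_succ_iff.2 hlt⟩
  · intro hj
    refine isArc_iff.2 ⟨Fin.succ_pos j,
      (h.zero_iff j).2 ⟨j, hj, (inSameBlock_equivalence p).refl j⟩, fun x hx hlt => ?_⟩
    induction x using Fin.cases with
    | zero => exact hlt.1.false
    | succ x =>
      exact (ho j hj x ((h.isChild x j).2 hx)).not_gt (Fin.succ_lt_succ_iff.1 hlt.2)

lemma IsChildAt.ne'_eq {n : ℕ} {p : SetPartition n} {o : Option (Fin n)}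
    {c : SetPartition (n + 1)} (ho : ∀ b ∈ o, IsBlockMin p b) (h : IsChildAt p o c) :
    ne' c = ne' p + {e : Fin n × Fin n | ∃ b ∈ o, IsArc p e.1 e.2 ∧ e.2 < b}.ncard := by
  let f : Fin n × Fin n → Fin (n + 1) × Fin (n + 1) := Prod.map Fin.succ Fin.succ
  have hf : Function.Injective f := (Fin.succ_injective n).prodMap (Fin.succ_injective n)
  have hunion : {e : (Fin (n + 1) × Fin (n + 1)) × (Fin (n + 1) × Fin (n + 1)) |
      IsArc c e.1.1 e.1.2 ∧ IsArc c e.2.1 e.2.2 ∧ Nesting e.1 e.2} =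
      Prod.map f f '' {e | IsArc p e.1.1 e.1.2 ∧ IsArc p e.2.1 e.2.2 ∧ Nesting e.1 e.2} ∪
      (fun e => ((0, (o.elim 0 Fin.succ)), f e)) ''
        {e : Fin n × Fin n | ∃ b ∈ o, IsArc p e.1 e.2 ∧ e.2 < b} := by
    ext ⟨⟨i, j⟩, ⟨i', j'⟩⟩
    simp only [Set.mem_ofPred_eq, Set.mem_union, Set.mem_image, Prod.exists, Prod.map_apply, f,
      Prod.mk.injEq]
    constructor
    · rintro ⟨harc, harc', hlt, hlt', hlt''⟩
      simp only at hlt hlt' hlt''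
      obtain ⟨k', rfl⟩ := Fin.exists_succ_eq.2 (Fin.ne_zero_of_lt hlt)
      obtain ⟨l', rfl⟩ := Fin.exists_succ_eq.2 (Fin.ne_zero_of_lt hlt')
      obtain ⟨l, rfl⟩ := Fin.exists_succ_eq.2 (Fin.ne_zero_of_lt hlt'')
      rw [h.isArc_succ] at harc'
      rw [Fin.succ_lt_succ_iff] at hlt' hlt''
      induction i using Fin.cases with
      | zero =>
        rw [h.isArc_zero ho, Option.mem_def] at harc
        subst harc
        exact .inr ⟨k', l', ⟨l, rfl, harc', hlt''⟩, ⟨rfl, rfl⟩, rfl, rfl⟩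
      | succ k =>
        rw [h.isArc_succ] at harc
        rw [Fin.succ_lt_succ_iff] at hlt
        exact .inl ⟨k, l, k', l', ⟨harc, harc', hlt, hlt', hlt''⟩, ⟨rfl, rfl⟩, rfl, rfl⟩
    · rintro (⟨k, l, k', l', ⟨harc, harc', hlt, hlt', hlt''⟩, ⟨rfl, rfl⟩, rfl, rfl⟩ |
        ⟨k', l', ⟨b, hb, harc, hlt⟩, ⟨rfl, rfl⟩, rfl, rfl⟩)
      · exact ⟨(h.isArc_succ k l).2 harc, (h.isArc_succ k' l').2 harc',
          Fin.succ_lt_succ_iff.2 hlt, Fin.succ_lt_succ_iff.2 hlt', Fin.succ_lt_succ_iff.2 hlt''⟩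
      · obtain rfl := Option.mem_def.1 hb
        exact ⟨(h.isArc_zero ho b).2 rfl, (h.isArc_succ k' l').2 harc, Fin.succ_pos k',
          Fin.succ_lt_succ_iff.2 harc.1, Fin.succ_lt_succ_iff.2 hlt⟩
  rw [ne', hunion, Set.ncard_union_eq, Set.ncard_image_of_injective _ (hf.prodMap hf),
    Set.ncard_image_of_injective, ne']
  · exact fun e e' hee => hf (Prod.mk.inj hee).2
  · rw [Set.disjoint_left]
    rintro _ ⟨⟨⟨i, j⟩, e'⟩, -, rfl⟩ ⟨e, -, he⟩
    exact (Fin.succ_ne_zero i).symm (congrArg (fun x => x.1.1) he)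

lemma IsChildAt.ne'_none {n : ℕ} {p : SetPartition n} {c : SetPartition (n + 1)}
    (h : IsChildAt p none c) : ne' c = ne' p := by
  simp [h.ne'_eq (by simp)]

lemma IsChildAt.ne'_some {n : ℕ} {p : SetPartition n} {b : Fin n} {c : SetPartition (n + 1)}
    (hb : IsBlockMin p b) (h : IsChildAt p (some b) c) :
    ne' c = ne' p + #{x ∈ nonMins p | x < (b : ℕ)} := by
  simp [h.ne'_eq (by simpa using hb), ← ncard_arcs_left_of]

/-- The set of non-minimal elements together with the number of nestings: a complete invariant
of `∼_ne`. -/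
noncomputable def neData {n : ℕ} (p : SetPartition n) : Σ _ : Finset ℕ, ℕ :=
  ⟨nonMins p, ne' p⟩

lemma neData_eq_iff {n m : ℕ} {p : SetPartition n} {q : SetPartition m} :
    neData p = neData q ↔ nonMins p = nonMins q ∧ ne' p = ne' q := by
  simp [neData]

lemma exists_children_equiv {n : ℕ} {p q : SetPartition n} (h : neData p = neData q) :
    ∃ φ : {c // IsChild c p} ≃ {c // IsChild c q}, ∀ c, neData (φ c).1 = neData c.1 := by
  rw [neData_eq_iff] at h
  have hmin : ∀ b, IsBlockMin p b ↔ IsBlockMin q b := fun b => by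
    rw [← not_iff_not, ← val_mem_nonMins, ← val_mem_nonMins, h.1]
  have hstep : ∀ (p' q' : SetPartition n), (∀ b, IsBlockMin p' b ↔ IsBlockMin q' b) →
      ∀ c, IsChild c p' → ∃ d, IsChild d q' ∧
        ∃ o, (∀ b ∈ o, IsBlockMin p' b) ∧ IsChildAt p' o c ∧ IsChildAt q' o d := by
    intro p' q' _ c hc
    obtain ⟨o, ho, hoc⟩ := hc.exists_isChildAt
    obtain ⟨d, hd⟩ := exists_isChildAt q' o
    exact ⟨d, hd.isChild, o, ho, hoc, hd⟩
  choose f hf using hstep p q hmin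
  choose g hg using hstep q p fun b => (hmin b).symm
  refine ⟨⟨fun c => ⟨f c.1 c.2, (hf c.1 c.2).1⟩, fun c => ⟨g c.1 c.2, (hg c.1 c.2).1⟩,
    fun c => ?_, fun c => ?_⟩, fun c => ?_⟩
  · obtain ⟨hfc, o, ho, hoc, hod⟩ := hf c.1 c.2
    obtain ⟨hgc, o', ho', hoc', hod'⟩ := hg _ hfc
    obtain rfl := hod.option_eq (fun b hb => (hmin b).1 (ho b hb)) ho' hoc'
    exact Subtype.ext (hod'.eq hoc)
  · obtain ⟨hgc, o, ho, hoc, hod⟩ := hg c.1 c.2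
    obtain ⟨hfc, o', ho', hoc', hod'⟩ := hf _ hgc
    obtain rfl := hod.option_eq (fun b hb => (hmin b).2 (ho b hb)) ho' hoc'
    exact Subtype.ext (hod'.eq hoc)
  · obtain ⟨-, o, ho, hoc, hod⟩ := hf c.1 c.2
    rw [Equiv.coe_fn_mk, neData_eq_iff]
    rcases o with _ | b
    · rw [hod.nonMins_none, hoc.nonMins_none, hod.ne'_none, hoc.ne'_none, h.1, h.2]
      exact ⟨rfl, rfl⟩
    · have hb := ho b rfl
      have hb' := (hmin b).1 hb
      rw [hod.nonMins_some hb', hoc.nonMins_some hb, hod.ne'_some hb', hoc.ne'_some hb, h.1, h.2]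
      exact ⟨rfl, rfl⟩

lemma IsChild.parent_eq {n : ℕ} {p q : SetPartition n} {c : SetPartition (n + 1)}
    (hp : IsChild c p) (hq : IsChild c q) : p = q :=
  setPartition_ext fun i j => (hp i j).trans (hq i j).symm

/-- The next level of the tree, decomposed according to the parent. -/
noncomputable def levelSuccEquiv {n : ℕ} (p : SetPartition n) (l : ℕ) :
    (Σ t : level p l, {c // IsChild c t.1}) ≃ level p (l + 1) :=
  Equiv.ofBijective (fun x => ⟨x.2.1, x.1.1, x.1.2, x.2.2⟩) <| by
    constructor
    · rintro ⟨⟨t, ht⟩, ⟨c, hc⟩⟩ ⟨⟨t', ht'⟩, ⟨c', hc'⟩⟩ h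
      obtain rfl : c = c' := congrArg Subtype.val h
      obtain rfl := IsChild.parent_eq hc hc'
      rfl
    · rintro ⟨c, t, ht, hc⟩
      exact ⟨⟨⟨t, ht⟩, ⟨c, hc⟩⟩, rfl⟩

lemma exists_level_equiv {n : ℕ} {p q : SetPartition n} (h : neData p = neData q) (l : ℕ) :
    ∃ φ : level p l ≃ level q l, ∀ t, neData (φ t).1 = neData t.1 := by
  induction l with
  | zero =>
    refine ⟨(Equiv.Set.singleton.{0} p).trans (Equiv.Set.singleton.{0} q).symm, fun t => ?_⟩
    obtain ⟨t, rfl⟩ := t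
    exact h.symm
  | succ l ih =>
    obtain ⟨φ, hφ⟩ := ih
    choose ψ hψ using fun t : level p l => exists_children_equiv (hφ t).symm
    refine ⟨(levelSuccEquiv p l).symm.trans ((Equiv.sigmaCongr φ ψ).trans (levelSuccEquiv q l)),
      fun t => ?_⟩
    obtain ⟨⟨t, c⟩, rfl⟩ := (levelSuccEquiv p l).surjective t
    rw [Equiv.trans_apply, Equiv.symm_apply_apply]
    exact hψ t c

lemma card_parts_eq_iff {n : ℕ} (p : SetPartition n) (m : ℕ) :
    #p.parts = m ↔ #(nonMins p) + m = n := by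
  have := card_nonMins_add_card_parts p
  omega

lemma simNe_of_neData_eq {n : ℕ} {p q : SetPartition n} (h : neData p = neData q) :
    SimNe p q := by
  intro l m c
  obtain ⟨φ, hφ⟩ := exists_level_equiv h l
  refine Nat.card_congr (Equiv.trans (Equiv.Set.sep _ _) (Equiv.trans
    (Equiv.subtypeEquiv φ fun t => ?_) (Equiv.Set.sep _ _).symm))
  have := neData_eq_iff.1 (hφ t)
  simp only [Set.mem_ofPred_eq, card_parts_eq_iff, this]

lemma ncard_children {n : ℕ} (p : SetPartition n) (d : ℕ) :
    {t ∈ level p 1 | #t.parts = #p.parts ∧ ne' t = ne' p + d}.ncard =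
      #{b ∈ range n | b ∉ nonMins p ∧ #{x ∈ nonMins p | x < b} = d} := by
  refine Eq.trans (Eq.symm ?_) (Set.ncard_coe_finset _)
  have hex : ∀ b, b < n → ∃ c, ∀ h : b < n, IsChildAt p (some ⟨b, h⟩) c := fun b hb => by
    obtain ⟨c, hc⟩ := exists_isChildAt p (some ⟨b, hb⟩)
    exact ⟨c, fun _ => hc⟩
  choose f hf using hex
  have hmem : ∀ b ∈ ({b ∈ range n | b ∉ nonMins p ∧ #{x ∈ nonMins p | x < b} = d} : Finset ℕ),
      ∃ hb : b < n, IsBlockMin p ⟨b, hb⟩ ∧ #{x ∈ nonMins p | x < b} = d := fun b hb => by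
    rw [mem_filter, mem_range] at hb
    refine ⟨hb.1, ?_, hb.2.2⟩
    by_contra hmin
    exact hb.2.1 (val_mem_nonMins.2 hmin)
  have hcard : ∀ b (hb : b < n), IsBlockMin p ⟨b, hb⟩ →
      ∀ c, IsChildAt p (some ⟨b, hb⟩) c → #c.parts = #p.parts := fun b hb hmin c hc => by
    have h1 := card_nonMins_add_card_parts c
    rw [hc.nonMins_some hmin, card_insert_of_notMem, card_image_succ] at h1
    · have := card_nonMins_add_card_parts p
      omega
    · rw [succ_mem_image_succ]
      exact fun h => val_mem_nonMins.1 h hmin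
  refine Set.ncard_congr (fun b hb => f b (hmem b hb).1) ?_ ?_ ?_
  · intro b hb
    obtain ⟨hbn, hmin, hd⟩ := hmem b hb
    have hc := hf b hbn hbn
    refine ⟨⟨p, rfl, hc.isChild⟩, hcard b hbn hmin _ hc, ?_⟩
    rw [hc.ne'_some hmin, hd]
  · intro b b' hb hb' heq
    obtain ⟨hbn, hmin, -⟩ := hmem b hb
    obtain ⟨hbn', hmin', -⟩ := hmem b' hb'
    have := IsChildAt.option_eq (by simpa using hmin) (by simpa using hmin') (hf b hbn hbn)
      (heq ▸ hf b' hbn' hbn')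
    simpa using this
  · rintro c ⟨⟨q, rfl, hc⟩, hparts, hne⟩
    obtain ⟨o, ho, hoc⟩ := hc.exists_isChildAt
    rcases o with _ | ⟨b, hb⟩
    · have h1 := card_nonMins_add_card_parts c
      have h2 := card_nonMins_add_card_parts (n := n) q
      rw [hoc.nonMins_none, card_image_succ, hparts] at h1
      omega
    · have hmin := ho _ rfl
      refine ⟨b, ?_, (hf b hb hb).eq hoc⟩
      rw [hoc.ne'_some hmin] at hne
      rw [mem_coe, mem_filter, mem_range]
      exact ⟨hb, fun h => val_mem_nonMins.1 h hmin, by simpa using hne⟩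

lemma SimNe.neData_eq {n : ℕ} {p q : SetPartition n} (h : SimNe p q) : neData p = neData q := by
  have h0 : #q.parts = #p.parts ∧ ne' q = ne' p := by
    have hone : {t ∈ level p 0 | #t.parts = #p.parts ∧ ne' t = ne' p} = {p} := by
      ext t
      constructor
      · exact fun ht => ht.1
      · rintro rfl
        exact ⟨rfl, rfl, rfl⟩
    have := h 0 #p.parts (ne' p)
    rw [hone, Set.ncard_singleton] at this
    obtain ⟨t, rfl, ht⟩ := Set.nonempty_of_ncard_ne_zero (this ▸ one_ne_zero)
    exact ht
  rw [neData_eq_iff]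
  refine ⟨eq_of_card_filter_eq (nonMins_subset_range p) (nonMins_subset_range q) fun d => ?_,
    h0.2.symm⟩
  rw [← ncard_children, ← ncard_children, h0.1, h0.2]
  exact h 1 _ _

lemma ne'_le_nestBound {n : ℕ} (p : SetPartition n) : ne' p ≤ nestBound (nonMins p) := by
  induction n with
  | zero =>
    have : {e : (Fin 0 × Fin 0) × (Fin 0 × Fin 0) |
      IsArc p e.1.1 e.1.2 ∧ IsArc p e.2.1 e.2.2 ∧ Nesting e.1 e.2} = ∅ := Set.eq_empty_of_isEmpty _
    simp [ne', this]
  | succ n ih =>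
    obtain ⟨q, hq⟩ := exists_setPartition
      (Setoid.comap Fin.succ ⟨InSameBlock p, inSameBlock_equivalence p⟩)
    have hchild : IsChild p q := hq
    obtain ⟨o, ho, hoc⟩ := hchild.exists_isChildAt
    rcases o with _ | b
    · rw [hoc.ne'_none, hoc.nonMins_none]
      exact (ih q).trans (nestBound_le_image_succ _)
    · have hb := ho b rfl
      rw [hoc.ne'_some hb, hoc.nonMins_some hb, nestBound_insert_image_succ
        (fun e he => (mem_Icc.1 (nonMins_subset q he)).1) fun h => val_mem_nonMins.1 h hb]
      exact add_le_add (ih q) (card_filter_lt_le_min _ _)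

lemma exists_neData_eq {n c : ℕ} {E : Finset ℕ} (hE : E ⊆ Icc 1 (n - 1)) (hc : c ≤ nestBound E) :
    ∃ p : SetPartition n, neData p = ⟨E, c⟩ := by
  induction n generalizing E c with
  | zero =>
    obtain rfl : E = ∅ := by simpa using hE
    obtain ⟨p, -⟩ := exists_setPartition (⊥ : Setoid (Fin 0))
    have h0 : nonMins p = ∅ := by simpa using nonMins_subset p
    have h1 := ne'_le_nestBound p
    rw [h0] at h1
    simp only [nestBound, sum_empty, Nat.zero_sub, Nat.le_zero] at h1 hc
    exact ⟨p, by rw [neData, h0, h1, hc]⟩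
  | succ n ih =>
    rcases E.eq_empty_or_nonempty with rfl | hne
    · obtain ⟨p, hp⟩ := ih (empty_subset _) hc
      obtain ⟨d, hd⟩ := exists_isChildAt p none
      refine ⟨d, ?_⟩
      simp only [neData, Sigma.mk.injEq, heq_eq_eq] at hp ⊢
      rw [hd.nonMins_none, hd.ne'_none, hp.1, hp.2]
      simp
    · obtain ⟨E', b, hE', hbn, hb, rfl, hle, hle'⟩ := exists_predecessor hE hne hc
      obtain ⟨p, hp⟩ := ih hE' hle'
      obtain ⟨d, hd⟩ := exists_isChildAt p (some ⟨b, hbn⟩)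
      simp only [neData, Sigma.mk.injEq, heq_eq_eq] at hp
      have hmin : IsBlockMin p ⟨b, hbn⟩ := by
        by_contra h
        exact hb (hp.1 ▸ val_mem_nonMins.2 h)
      refine ⟨d, ?_⟩
      simp only [neData, Sigma.mk.injEq, heq_eq_eq]
      rw [hd.nonMins_some hmin, hd.ne'_some hmin, hp.1, hp.2]
      exact ⟨rfl, by simp only; omega⟩

lemma fnk_add_one (N k : ℕ) : fnk (N + (k + 1)) (k + 1) = countPairs N k := by
  let f : {p : SetPartition (N + (k + 1)) // #p.parts = k + 1} → Σ _ : Finset ℕ, ℕ :=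
    fun p => neData p.1
  have hker : neSetoid (N + (k + 1)) (k + 1) = Setoid.ker f := by
    ext p q
    exact ⟨SimNe.neData_eq, simNe_of_neData_eq⟩
  have hrange : Set.range f =
      ((powersetCard N (Icc 1 (N + k))).sigma fun E => range (nestBound E + 1) :
        Finset (Σ _ : Finset ℕ, ℕ)) := by
    ext ⟨E, c⟩
    simp only [Set.mem_range, coe_sigma, Set.mem_sigma_iff, mem_coe, mem_powersetCard, mem_range,
      Nat.lt_succ_iff]
    constructor
    · rintro ⟨⟨p, hp⟩, hpE⟩
      simp only [f, neData, Sigma.mk.injEq, heq_eq_eq] at hpE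
      obtain ⟨rfl, rfl⟩ := hpE
      rw [card_parts_eq_iff] at hp
      exact ⟨⟨nonMins_subset p, by omega⟩, ne'_le_nestBound p⟩
    · rintro ⟨⟨hE, hcard⟩, hc⟩
      obtain ⟨p, hp⟩ := exists_neData_eq (n := N + (k + 1)) hE hc
      have hEp : nonMins p = E := congrArg Sigma.fst hp
      exact ⟨⟨p, by rw [card_parts_eq_iff, hEp, hcard]⟩, hp⟩
  rw [fnk, hker, Nat.card_congr (Setoid.quotientKerEquivRange f), Nat.card_coe_set_eq, hrange,
    Set.ncard_coe_finset, card_sigma, countPairs]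
  simp

/-- Theorem 4.6. `f_{n,1} = 1` for `n ≥ 1`, and for `n ≥ k ≥ 2`,
`f_{n,k} = Σ_{r=k-1}^{n-1} f_{r,k-1} + (k-1)·C(n-2,k)`. -/
theorem statement17 :
    (∀ n : ℕ, 1 ≤ n → fnk n 1 = 1) ∧
    (∀ n k : ℕ, 2 ≤ k → k ≤ n →
      fnk n k = (∑ r ∈ Finset.Icc (k - 1) (n - 1), fnk r (k - 1))
        + (k - 1) * (n - 2).choose k) := by
  refine ⟨fun n hn => ?_, fun n k hk hkn => ?_⟩
  · obtain ⟨N, rfl⟩ := Nat.exists_eq_add_of_le' hn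
    rw [fnk_add_one N 0, countPairs_blocks_zero]
  · obtain ⟨k, rfl⟩ := Nat.exists_eq_add_of_le' hk
    obtain ⟨N, rfl⟩ := Nat.exists_eq_add_of_le' hkn
    have hsum : ∑ r ∈ Finset.Icc (k + 2 - 1) (N + (k + 2) - 1), fnk r (k + 2 - 1) =
        ∑ M ∈ range (N + 1), countPairs M k := by
      rw [← Finset.Ico_add_one_right_eq_Icc, Finset.sum_Ico_eq_sum_range]
      refine sum_congr (by congr 1; omega) fun M _ => ?_
      rw [← fnk_add_one, Nat.add_comm M]
      rfl
    rw [hsum, fnk_add_one N (k + 1), countPairs_succ_eq_sum]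
    congr 2
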